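/- arXiv:2305.02570 — 2 statements merged into one kernel-verified Lean document; each statement's English description precedes it below -/
import Mathlib

section
/- There exists a universal constant C such that every K_{1,k}-free graph G with maximum degree Δ ≥ 2 and no isolated vertices satisfies χ_ON(G) ≤ C·k·ln Δ. (Specifically one may take χ_ON(G) ≤ 46k·ln Δ + 2k + 3.) -/
open Finset

/-- `f` is a CFON coloring of `G`: every vertex has a color appearing
exactly once in its open neighborhood. -/
def IsCFONColoring {V : Type} (G : SimpleGraph V) {k : ℕ} (f : V → Fin k) : Prop :=
  ∀ v : V, ∃ c : Fin k, ∃! u : V, u ∈ G.neighborSet v ∧ f u = c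

/-- `f` is a CFCN coloring of `G`: every vertex has a color appearing
exactly once in its closed neighborhood. -/
def IsCFCNColoring {V : Type} (G : SimpleGraph V) {k : ℕ} (f : V → Fin k) : Prop :=
  ∀ v : V, ∃ c : Fin k, ∃! u : V, u ∈ insert v (G.neighborSet v) ∧ f u = c

/-- The CFON chromatic number of `G`. -/
noncomputable def chiON {V : Type} [Fintype V] (G : SimpleGraph V) : ℕ :=
  sInf {k : ℕ | ∃ f : V → Fin k, IsCFONColoring G f}

/-- The CFCN chromatic number of `G`. -/
noncomputable def chiCN {V : Type} [Fintype V] (G : SimpleGraph V) : ℕ :=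
  sInf {k : ℕ | ∃ f : V → Fin k, IsCFCNColoring G f}

/-- `G` is `K_{1,k}`-free: it contains no induced star `K_{1,k}`, i.e. no vertex `v`
with `k` pairwise nonadjacent neighbors. -/
def K1kFree {V : Type} (G : SimpleGraph V) (k : ℕ) : Prop :=
  ¬ ∃ (v : V) (T : Finset V), T.card = k ∧ v ∉ T ∧ (∀ u ∈ T, G.Adj v u) ∧
      ∀ u ∈ T, ∀ w ∈ T, u ≠ w → ¬ G.Adj u w

/-- Some element of `E` has a color not shared by other elements of `E`. -/
def HasUniq {V α : Type} (f : V → α) (E : Finset V) : Prop :=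
  ∃ p ∈ E, ∀ y ∈ E, y ≠ p → f y ≠ f p

lemma greedy_cf {V ι : Type} [Fintype V] [Fintype ι] [DecidableEq V] (E : ι → Finset V) (D : ℕ)
    (hD : ∀ x, (univ.filter (fun i => x ∈ E i)).card ≤ D) :
    ∃ g : V → Fin (D + 1), ∀ i, (E i).Nonempty → HasUniq g (E i) := by
  classical
  have key : ∀ X : Finset V, ∃ g : V → Fin (D + 1), ∀ i, (E i ∩ X).Nonempty →
      HasUniq g (E i ∩ X) := by
    intro X
    induction X using Finset.induction_on with
    | empty => exact ⟨fun _ => 0, fun i h => by simp at h⟩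
    | insert x X hx ih =>
      obtain ⟨g, hg⟩ := ih
      have : ∀ i, ∃ p : V, (E i ∩ X).Nonempty →
          p ∈ E i ∩ X ∧ ∀ y ∈ E i ∩ X, y ≠ p → g y ≠ g p := by
        intro i
        by_cases h : (E i ∩ X).Nonempty
        · obtain ⟨p, hp, hp2⟩ := hg i h
          exact ⟨p, fun _ => ⟨hp, hp2⟩⟩
        · exact ⟨x, fun h' => absurd h' h⟩
      choose p hp using this
      let F : Finset (Fin (D + 1)) := (univ.filter (fun i => x ∈ E i)).image (fun i => g (p i))
      have hF : F.card < (univ : Finset (Fin (D + 1))).card := by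
        have h1 : F.card ≤ D := card_image_le.trans (hD x)
        simpa using Nat.lt_succ_of_le h1
      obtain ⟨c, -, hc⟩ := Finset.exists_mem_notMem_of_card_lt_card hF
      have hc' : ∀ i, x ∈ E i → g (p i) ≠ c := by
        intro i hi h
        exact hc (mem_image.2 ⟨i, by simp [hi], h⟩)
      refine ⟨Function.update g x c, fun i hi => ?_⟩
      by_cases h : (E i ∩ X).Nonempty
      · obtain ⟨h1, h2⟩ := hp i h
        have hpx : p i ≠ x := by
          rintro h3
          rw [h3] at h1
          exact hx (mem_inter.1 h1).2
        refine ⟨p i, ?_, ?_⟩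
        · simp only [mem_inter, mem_insert] at h1 ⊢
          exact ⟨h1.1, Or.inr h1.2⟩
        · intro y hy hyp
          rw [Function.update_of_ne hpx]
          by_cases hyx : y = x
          · subst hyx
            rw [Function.update_self]
            exact (hc' i (mem_inter.1 hy).1).symm
          · rw [Function.update_of_ne hyx]
            apply h2 y _ hyp
            simp only [mem_inter, mem_insert] at hy ⊢
            exact ⟨hy.1, hy.2.resolve_left hyx⟩
      · have hall : ∀ y ∈ E i ∩ insert x X, y = x := by
          intro y hy
          simp only [mem_inter, mem_insert] at hy
          rcases hy.2 with h3 | h3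
          · exact h3
          · exact absurd ⟨y, mem_inter.2 ⟨hy.1, h3⟩⟩ h
        obtain ⟨z, hz⟩ := hi
        have hzx := hall z hz
        subst hzx
        exact ⟨z, hz, fun y hy hyz => absurd (hall y hy) hyz⟩
  obtain ⟨g, hg⟩ := key univ
  exact ⟨g, fun i hi => by simpa using hg i (by simpa using hi)⟩

open Classical in
/-- Independence of disjoint sets of coordinates. -/
lemma indep_card {V α : Type} [Fintype V] [Fintype α] (E : Finset V)
    (A B : (V → α) → Prop)
    (hA : ∀ f g : V → α, (∀ x, x ∉ E → f x = g x) → A f → A g)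
    (hB : ∀ f g : V → α, (∀ x, x ∈ E → f x = g x) → B f → B g) :
    (univ.filter (fun f => A f ∧ B f)).card * Fintype.card (V → α) ≤
      (univ.filter A).card * (univ.filter B).card := by
  rw [← Finset.card_univ, ← Finset.card_product, ← Finset.card_product]
  let mix : (V → α) → (V → α) → V → α := fun f g x => if x ∈ E then f x else g x
  apply Finset.card_le_card_of_injOn (fun q => (mix q.2 q.1, mix q.1 q.2))
  · rintro ⟨f, g⟩ h
    simp only [coe_product, Set.mem_prod, mem_coe, mem_filter, mem_univ, true_and, and_true] at h ⊢
    refine ⟨hA f _ (fun x hx => by simp [mix, hx]) h.1, hB f _ (fun x hx => by simp [mix, hx]) h.2⟩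
  · rintro ⟨f, g⟩ - ⟨f', g'⟩ - h
    simp only [Prod.mk.injEq] at h
    obtain ⟨h1, h2⟩ := h
    have h1' := fun x => congrFun h1 x
    have h2' := fun x => congrFun h2 x
    simp only [mix] at h1' h2'
    refine Prod.ext (funext fun x => ?_) (funext fun x => ?_)
    · by_cases hx : x ∈ E
      · simpa [hx] using h2' x
      · simpa [hx] using h1' x
    · by_cases hx : x ∈ E
      · simpa [hx] using h1' x
      · simpa [hx] using h2' x

lemma HasUniq.congr {V α : Type} {f g : V → α} {E : Finset V} (h : ∀ x ∈ E, f x = g x)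
    (hf : HasUniq f E) : HasUniq g E := by
  obtain ⟨p, hp, h2⟩ := hf
  refine ⟨p, hp, fun y hy hyp => ?_⟩
  rw [← h y hy, ← h p hp]
  exact h2 y hy hyp

open Classical in
/-- Counting version of the local lemma for conflict-free colorings. -/
lemma local_cf {V ι α : Type} [Fintype V] [Fintype ι] [Fintype α] [Nonempty α]
    (E : ι → Finset V) (hE : ∀ i, (E i).Nonempty) (w : ι → ℝ)
    (hw : ∀ i, ((univ.filter (fun f : V → α => ¬ HasUniq f (E i))).card : ℝ) * 2 ^ (E i).card
      ≤ w i * Fintype.card (V → α))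
    (hsum : ∀ x, ∑ i ∈ univ.filter (fun i => x ∈ E i), w i ≤ 1) :
    ∃ f : V → α, ∀ i, HasUniq f (E i) := by
  let P : Finset V → (V → α) → Prop := fun X f => ∀ i, E i ⊆ X → HasUniq f (E i)
  let c : Finset V → ℝ := fun X => ((univ.filter (P X)).card : ℝ)
  have hN : (0 : ℝ) < Fintype.card (V → α) := by exact_mod_cast Fintype.card_pos
  have hc0 : ∀ X, 0 ≤ c X := fun X => Nat.cast_nonneg _
  have step : ∀ n, ∀ X : Finset V, X.card = n → ∀ x, x ∉ X → c X ≤ 2 * c (insert x X) := by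
    intro n
    induction n using Nat.strong_induction_on with
    | _ n ih =>
    intro X hX x hx
    -- removing several elements
    have rem : ∀ Z : Finset V, ∀ Y : Finset V, Disjoint Y Z → Y ∪ Z ⊆ X →
        c Y ≤ 2 ^ Z.card * c (Y ∪ Z) := by
      intro Z
      induction Z using Finset.induction_on with
      | empty => intro Y _ _; simp
      | insert z Z hz ihZ =>
        intro Y hd hs
        rw [Finset.disjoint_insert_right] at hd
        have hs' : Y ∪ Z ⊂ X := by
          refine ⟨fun y hy => hs (by
            simp only [mem_union, mem_insert] at hy ⊢; tauto), fun h => ?_⟩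
          have : z ∈ Y ∪ Z := h (hs (by simp))
          simp only [mem_union] at this
          tauto
        have h1 := ihZ Y hd.2 hs'.1
        have h2 := ih (Y ∪ Z).card (hX ▸ Finset.card_lt_card hs') (Y ∪ Z) rfl z
          (by simp only [mem_union]; tauto)
        rw [Finset.card_insert_of_notMem hz, Finset.union_insert, pow_succ]
        have h3 : (0 : ℝ) ≤ 2 ^ Z.card := by positivity
        nlinarith
    let I : Finset ι := univ.filter (fun i => x ∈ E i ∧ E i ⊆ insert x X)
    let B : ι → Finset (V → α) := fun i =>
      univ.filter (fun f => P (X \ E i) f ∧ ¬ HasUniq f (E i))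
    have hsub : univ.filter (P X) ⊆ univ.filter (P (insert x X)) ∪ I.biUnion B := by
      intro f hf
      simp only [mem_filter, mem_univ, true_and, mem_union, mem_biUnion] at hf ⊢
      by_cases h : P (insert x X) f
      · exact Or.inl h
      · right
        simp only [P, not_forall] at h
        obtain ⟨i, hi, hbad⟩ := h
        refine ⟨i, ?_, ?_⟩
        · simp only [I, mem_filter, mem_univ, true_and]
          refine ⟨?_, hi⟩
          by_contra hxi
          exact hbad (hf i ((Finset.subset_insert_iff_of_notMem hxi).1 hi))
        · simp only [B, mem_filter, mem_univ, true_and]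
          exact ⟨fun j hj => hf j (hj.trans sdiff_subset), hbad⟩
    have hB : ∀ i ∈ I, ((B i).card : ℝ) ≤ w i / 2 * c X := by
      intro i hi
      simp only [I, mem_filter, mem_univ, true_and] at hi
      have h1 := indep_card (α := α) (E i) (P (X \ E i)) (fun f => ¬ HasUniq f (E i))
        (by
          intro f g hfg hf j hj
          refine (hf j hj).congr fun y hy => hfg y ?_
          exact (mem_sdiff.1 (hj hy)).2)
        (by
          intro f g hfg hf hg
          exact hf (hg.congr fun y hy => (hfg y hy).symm))
      have h1' : ((B i).card : ℝ) * Fintype.card (V → α) ≤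
          c (X \ E i) * ((univ.filter (fun f : V → α => ¬ HasUniq f (E i))).card : ℝ) := by
        have h1n : (B i).card * Fintype.card (V → α) ≤ (univ.filter (P (X \ E i))).card *
            (univ.filter (fun f : V → α => ¬ HasUniq f (E i))).card := by
          convert h1
        have h1r := (Nat.cast_le (α := ℝ)).2 h1n
        rw [Nat.cast_mul, Nat.cast_mul] at h1r
        exact h1r
      have h2 := rem ((E i).erase x) (X \ E i)
        (by
          rw [Finset.disjoint_left]
          intro y hy hy'
          exact (mem_sdiff.1 hy).2 (mem_of_mem_erase hy'))
        (by
          intro y hy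
          simp only [mem_union, mem_sdiff, mem_erase] at hy
          rcases hy with hy | hy
          · exact hy.1
          · exact (mem_insert.1 (hi.2 hy.2)).resolve_left hy.1)
      have h3 : X \ E i ∪ (E i).erase x = X := by
        ext y
        simp only [mem_union, mem_sdiff, mem_erase]
        constructor
        · rintro (hy | hy)
          · exact hy.1
          · exact (mem_insert.1 (hi.2 hy.2)).resolve_left hy.1
        · intro hy
          by_cases hyE : y ∈ E i
          · exact Or.inr ⟨fun h => hx (h ▸ hy), hyE⟩
          · exact Or.inl ⟨hy, hyE⟩
      rw [h3] at h2
      have h4 : (2 : ℝ) ^ (E i).card = 2 * 2 ^ ((E i).erase x).card := by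
        rw [← Finset.card_erase_add_one hi.1, pow_succ]; ring
      have h5 := hw i
      rw [h4] at h5
      set b := ((univ.filter (fun f : V → α => ¬ HasUniq f (E i))).card : ℝ) with hb
      have hb0 : 0 ≤ b := Nat.cast_nonneg _
      have h6 : ((B i).card : ℝ) * Fintype.card (V → α) ≤
          (w i / 2 * c X) * Fintype.card (V → α) := by
        calc _ ≤ c (X \ E i) * b := h1'
          _ ≤ (2 ^ ((E i).erase x).card * c X) * b := by gcongr
          _ = c X * (b * (2 * 2 ^ ((E i).erase x).card)) / 2 := by ring
          _ ≤ c X * (w i * Fintype.card (V → α)) / 2 := by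
              have := hc0 X
              gcongr
          _ = _ := by ring
      exact le_of_mul_le_mul_right h6 hN
    have hw0 : ∀ i, 0 ≤ w i := by
      intro i
      have : 0 ≤ w i * Fintype.card (V → α) := le_trans (by positivity) (hw i)
      exact nonneg_of_mul_nonneg_left this hN
    have h7 : c X ≤ c (insert x X) + ∑ i ∈ I, ((B i).card : ℝ) := by
      have h8 := (Finset.card_le_card hsub).trans (Finset.card_union_le _ _)
      have h9 := h8.trans (Nat.add_le_add_left (Finset.card_biUnion_le) _)
      have h11 := (Nat.cast_le (α := ℝ)).2 h9
      rw [Nat.cast_add, Nat.cast_sum] at h11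
      exact h11
    have h10 : ∑ i ∈ I, ((B i).card : ℝ) ≤ 1 / 2 * c X := by
      calc _ ≤ ∑ i ∈ I, w i / 2 * c X := Finset.sum_le_sum hB
        _ = (∑ i ∈ I, w i) / 2 * c X := by rw [← Finset.sum_mul, Finset.sum_div]
        _ ≤ (∑ i ∈ univ.filter (fun i => x ∈ E i), w i) / 2 * c X := by
            have := hc0 X
            gcongr
            · intro i _ _; exact hw0 i
            · intro i hi
              simp only [I, mem_filter, mem_univ, true_and] at hi ⊢
              exact hi.1
        _ ≤ 1 / 2 * c X := by
            have := hc0 X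
            gcongr
            exact hsum x
    linarith
  have hpos : ∀ X, 0 < c X := by
    intro X
    induction X using Finset.induction_on with
    | empty =>
      have : P ∅ (fun _ => Classical.arbitrary α) := by
        intro i hi
        exact absurd (Finset.subset_empty.1 hi) (hE i).ne_empty
      have : 0 < (univ.filter (P ∅)).card := Finset.card_pos.2 ⟨_, by simpa using this⟩
      exact Nat.cast_pos.2 this
    | insert x X hx ihX =>
      have := step _ X rfl x hx
      linarith
  have h := hpos univ
  have h' : 0 < (univ.filter (P univ)).card := Nat.cast_pos.1 h
  obtain ⟨f, hf⟩ := Finset.card_pos.1 h'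
  simp only [mem_filter, mem_univ, true_and] at hf
  exact ⟨f, fun i => hf i (subset_univ _)⟩

open Classical in
/-- Number of colorings without a uniquely colored element of `E`. -/
lemma card_bad {V : Type} [Fintype V] (r : ℕ) (E : Finset V) (hr : E.card / 2 ≤ r) :
    (univ.filter (fun f : V → Fin r => ¬ HasUniq f E)).card * r ^ E.card ≤
      r.choose (E.card / 2) * (E.card / 2) ^ E.card * Fintype.card (V → Fin r) := by
  set t := E.card / 2 with ht
  let Q : Finset (Fin r) → Finset (V → Fin r) := fun T =>
    Fintype.piFinset (fun x => if x ∈ E then T else univ)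
  have hsub : univ.filter (fun f : V → Fin r => ¬ HasUniq f E) ⊆
      (powersetCard t (univ : Finset (Fin r))).biUnion Q := by
    intro f hf
    simp only [mem_filter, mem_univ, true_and] at hf
    have h1 : (E.image f).card * 2 ≤ E.card := by
      rw [mul_comm]
      apply Finset.mul_card_image_le_card
      intro a ha
      obtain ⟨x, hx, rfl⟩ := mem_image.1 ha
      have : ∃ y ∈ E, y ≠ x ∧ f y = f x := by
        by_contra h
        push Not at h
        exact hf ⟨x, hx, h⟩
      obtain ⟨y, hy, hyx, hfy⟩ := this
      exact (Finset.one_lt_card.2 ⟨y, by simp [hy, hfy], x, by simp [hx], hyx⟩)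
    obtain ⟨T, hT1, -, hT2⟩ := Finset.exists_subsuperset_card_eq (subset_univ (E.image f))
      (n := t) (by omega) (by simpa using hr)
    simp only [mem_biUnion, mem_powersetCard]
    refine ⟨T, ⟨subset_univ _, hT2⟩, ?_⟩
    simp only [Q, Fintype.mem_piFinset]
    intro x
    split_ifs with hx
    · exact hT1 (mem_image_of_mem f hx)
    · simp
  have hQ : ∀ T ∈ powersetCard t (univ : Finset (Fin r)),
      (Q T).card = t ^ E.card * r ^ (univ \ E).card := by
    intro T hT
    simp only [Q, Fintype.card_piFinset]
    rw [← Finset.prod_sdiff (subset_univ E), mul_comm]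
    congr 1
    · rw [Finset.prod_congr rfl (g := fun _ => t)]
      · simp
      · intro x hx
        simp [hx, (mem_powersetCard.1 hT).2]
    · rw [Finset.prod_congr rfl (g := fun _ => r)]
      · simp
      · intro x hx
        simp [(mem_sdiff.1 hx).2]
  have hcard : Fintype.card (V → Fin r) = r ^ (univ \ E).card * r ^ E.card := by
    rw [← pow_add, Finset.card_sdiff_add_card_eq_card (subset_univ E)]
    simp
  rw [hcard]
  calc _ ≤ (∑ T ∈ powersetCard t (univ : Finset (Fin r)), (Q T).card) * r ^ E.card := by
        gcongr
        exact (Finset.card_le_card hsub).trans Finset.card_biUnion_le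
    _ = _ := by
        rw [Finset.sum_congr rfl hQ, Finset.sum_const, Finset.card_powersetCard]
        simp
        ring

lemma choose_mul_bound (r t : ℕ) : (r.choose t : ℝ) * (t : ℝ) ^ t ≤ (3 * r) ^ t := by
  have h1 : (r.choose t : ℝ) ≤ (r : ℝ) ^ t / t.factorial := Nat.choose_le_pow_div t r
  have h2 : (t : ℝ) ^ t / t.factorial ≤ 3 ^ t := by
    refine (Real.pow_div_factorial_le_exp (t : ℝ) (by positivity) t).trans ?_
    rw [← Real.exp_one_pow]
    exact pow_le_pow_left₀ (Real.exp_pos 1).le Real.exp_one_lt_three.le t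
  calc _ ≤ (r : ℝ) ^ t / t.factorial * (t : ℝ) ^ t := by gcongr
    _ = (r : ℝ) ^ t * ((t : ℝ) ^ t / t.factorial) := by ring
    _ ≤ (r : ℝ) ^ t * 3 ^ t := by gcongr
    _ = _ := by rw [← mul_pow, mul_comm]

lemma weight_bound (d s : ℕ) (hs : 2 ≤ s) (hd : s ≤ d) :
    ((18 * d : ℕ).choose (s / 2) : ℝ) * ((s / 2 : ℕ) : ℝ) ^ s ≤
      (2 * (s / 2 : ℕ) / (3 * d) : ℝ) ^ (s / 2) * (9 * d) ^ s := by
  set t := s / 2 with ht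
  have hd0 : (0 : ℝ) < d := by exact_mod_cast (by omega : 0 < d)
  have h1 := choose_mul_bound (18 * d) t
  push_cast at h1
  have htd : (t : ℝ) ≤ 9 * d := by exact_mod_cast (by omega : t ≤ 9 * d)
  have main : ((18 * d : ℕ).choose t : ℝ) * (t : ℝ) ^ (2 * t) ≤
      (2 * t / (3 * d) : ℝ) ^ t * (9 * d) ^ (2 * t) := by
    calc _ = (((18 * d : ℕ).choose t : ℝ) * (t : ℝ) ^ t) * (t : ℝ) ^ t := by
          rw [two_mul, pow_add]; ring
      _ ≤ (3 * (18 * d)) ^ t * (t : ℝ) ^ t := by gcongr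
      _ = _ := by
          rw [pow_mul, ← mul_pow, ← mul_pow]
          congr 1
          field_simp
          ring
  rcases Nat.even_or_odd' s with ⟨u, hu | hu⟩
  · have : s = 2 * t := by omega
    rw [this]; exact main
  · have : s = 2 * t + 1 := by omega
    rw [this, pow_succ, pow_succ, ← mul_assoc, ← mul_assoc]
    gcongr

lemma weight_small (d s : ℕ) (hs : 2 ≤ s) (hd : s ≤ d) :
    (2 * (s / 2 : ℕ) / (3 * d) : ℝ) ^ (s / 2) ≤ 2 / (3 * d) := by
  obtain ⟨u, hu⟩ : ∃ u, s / 2 = u + 1 := ⟨s / 2 - 1, by omega⟩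
  have hd0 : (0 : ℝ) < d := by exact_mod_cast (by omega : 0 < d)
  have hq : (2 * (s / 2 : ℕ) / (3 * d) : ℝ) ≤ 1 / 3 := by
    have : (2 * (s / 2 : ℕ) : ℝ) ≤ d := by exact_mod_cast (by omega : 2 * (s / 2) ≤ d)
    rw [div_le_div_iff₀ (by positivity) (by norm_num)]
    linarith
  rw [hu] at hq ⊢
  rw [pow_succ]
  have h3 : ((u + 1 : ℕ) : ℝ) ≤ 3 ^ u := by
    have : u < 3 ^ u := Nat.lt_pow_self (by norm_num)
    exact_mod_cast this
  calc _ ≤ (1 / 3 : ℝ) ^ u * (2 * (u + 1 : ℕ) / (3 * d)) := by gcongr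
    _ = ((u + 1 : ℕ) / 3 ^ u) * (2 / (3 * d)) := by rw [one_div, inv_pow]; ring
    _ ≤ 1 * (2 / (3 * d)) := by
        gcongr
        rw [div_le_one (by positivity)]
        exact h3
    _ = _ := one_mul _

lemma weight_large (d s m D : ℕ) (hm : 1 ≤ m) (hs : 2 * m ≤ s) (hd : s ≤ d) (hD : 0 < D)
    (hmD : 3 * D ≤ 3 ^ m) :
    (2 * (s / 2 : ℕ) / (3 * d) : ℝ) ^ (s / 2) ≤ 1 / (3 * D) := by
  have hd0 : (0 : ℝ) < d := by exact_mod_cast (by omega : 0 < d)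
  have hD0 : (0 : ℝ) < D := by exact_mod_cast hD
  have hq : (2 * (s / 2 : ℕ) / (3 * d) : ℝ) ≤ 1 / 3 := by
    have : (2 * (s / 2 : ℕ) : ℝ) ≤ d := by exact_mod_cast (by omega : 2 * (s / 2) ≤ d)
    rw [div_le_div_iff₀ (by positivity) (by norm_num)]
    linarith
  calc _ ≤ (1 / 3 : ℝ) ^ (s / 2) := by gcongr
    _ ≤ (1 / 3 : ℝ) ^ m := pow_le_pow_of_le_one (by norm_num) (by norm_num) (by omega)
    _ = 1 / 3 ^ m := by rw [one_div_pow]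
    _ ≤ _ := by
      apply one_div_le_one_div_of_le (by positivity)
      exact_mod_cast hmD

open Classical in
lemma indep_nbr {V : Type} [Fintype V] (G : SimpleGraph V) (k : ℕ) (hk : 2 ≤ k)
    (hG : K1kFree G k) (A : Finset V) (hA : ∀ u ∈ A, ∀ w ∈ A, ¬ G.Adj u w) (v : V) :
    (A.filter (fun u => G.Adj v u)).card ≤ k - 1 := by
  by_contra h
  obtain ⟨T, hT, hTk⟩ := Finset.exists_subset_card_eq (by omega :
    k ≤ (A.filter (fun u => G.Adj v u)).card)
  refine hG ⟨v, T, hTk, fun hv => ?_, fun u hu => (mem_filter.1 (hT hu)).2, fun u hu w hw _ =>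
    hA u (mem_filter.1 (hT hu)).1 w (mem_filter.1 (hT hw)).1⟩
  exact G.irrefl (mem_filter.1 (hT hv)).2

open Classical in
lemma exists_layers {V : Type} [Fintype V] (G : SimpleGraph V) (k : ℕ) (hk : 2 ≤ k)
    (hG : K1kFree G k) (a : ℕ) :
    ∃ S : Finset V, (∀ v, (S.filter (fun u => G.Adj v u)).card ≤ a * (k - 1)) ∧
      ∀ v, v ∉ S → a ≤ (S.filter (fun u => G.Adj v u)).card := by
  induction a with
  | zero => exact ⟨∅, by simp, by simp⟩
  | succ a ih =>
    obtain ⟨S, h1, h2⟩ := ih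
    let F : Finset (Finset V) := univ.filter
      (fun A => Disjoint A S ∧ ∀ u ∈ A, ∀ w ∈ A, ¬ G.Adj u w)
    obtain ⟨A, hA⟩ := F.exists_maximal ⟨∅, by simp [F]⟩
    have hAF := hA.prop
    simp only [F, mem_filter, mem_univ, true_and] at hAF
    have hun : ∀ v, ((S ∪ A).filter (fun u => G.Adj v u)).card =
        (S.filter (fun u => G.Adj v u)).card + (A.filter (fun u => G.Adj v u)).card := by
      intro v
      rw [filter_union, card_union_of_disjoint]
      exact Finset.disjoint_filter_filter hAF.1.symm
    refine ⟨S ∪ A, fun v => ?_, fun v hv => ?_⟩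
    · rw [hun, Nat.succ_mul]
      exact Nat.add_le_add (h1 v) (indep_nbr G k hk hG A hAF.2 v)
    · rw [hun]
      simp only [mem_union, not_or] at hv
      refine Nat.add_le_add (h2 v hv.1) (Finset.card_pos.2 ?_)
      by_contra hne
      have hno : ∀ u ∈ A, ¬ G.Adj v u := by
        intro u hu huv
        exact hne ⟨u, by simp [hu, huv]⟩
      have hins : insert v A ∈ F := by
        simp only [F, mem_filter, mem_univ, true_and, Finset.disjoint_insert_left]
        refine ⟨⟨hv.1, hAF.1⟩, ?_⟩
        intro u hu w hw
        rcases mem_insert.1 hu with hu1 | hu1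
        · rcases mem_insert.1 hw with hw1 | hw1
          · rw [hu1, hw1]
            exact G.irrefl
          · rw [hu1]
            exact hno w hw1
        · rcases mem_insert.1 hw with hw1 | hw1
          · rw [hw1]
            exact fun h => hno u hu1 h.symm
          · exact hAF.2 u hu1 w hw1
      exact hv.2 (hA.le_of_ge hins (Finset.subset_insert v A) (mem_insert_self v A))

lemma chiON_le_of {V α : Type} [Fintype V] [Fintype α] (G : SimpleGraph V) (f : V → α)
    (h : ∀ v, ∃ p, G.Adj v p ∧ ∀ y, G.Adj v y → y ≠ p → f y ≠ f p) :
    chiON G ≤ Fintype.card α := by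
  apply Nat.sInf_le
  refine ⟨fun v => Fintype.equivFin α (f v), fun v => ?_⟩
  obtain ⟨p, hp, h2⟩ := h v
  refine ⟨Fintype.equivFin α (f p), p, ⟨hp, rfl⟩, ?_⟩
  rintro y ⟨hy, hy2⟩
  by_contra hne
  exact h2 y hy hne ((Fintype.equivFin α).injective hy2)

lemma chiON_le_maxDegree {V : Type} [Fintype V] (G : SimpleGraph V) [DecidableRel G.Adj]
    (hiso : ∀ v : V, ∃ u : V, G.Adj v u) : chiON G ≤ G.maxDegree + 1 := by
  classical
  obtain ⟨g, hg⟩ := greedy_cf (fun v => G.neighborFinset v) G.maxDegree (by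
    intro x
    refine le_trans (le_of_eq ?_) (G.degree_le_maxDegree x)
    rw [← G.card_neighborFinset_eq_degree]
    congr 1
    ext v
    simp [G.adj_comm])
  have := chiON_le_of G g (by
    intro v
    obtain ⟨u, hu⟩ := hiso v
    obtain ⟨p, hp, h2⟩ := hg v ⟨u, by simpa using hu⟩
    exact ⟨p, by simpa using hp, fun y hy => h2 y (by simpa using hy)⟩)
  simpa using this

lemma chiON_le_layers {V : Type} [Fintype V] (G : SimpleGraph V) [DecidableRel G.Adj]
    (k : ℕ) (hk : 2 ≤ k) (hG : K1kFree G k) (hiso : ∀ v : V, ∃ u : V, G.Adj v u)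
    (hΔ : 0 < G.maxDegree) (m : ℕ) (hm : 1 ≤ m) (hm3 : 3 * G.maxDegree ≤ 3 ^ m) :
    chiON G ≤ 36 * m * (k - 1) + k := by
  classical
  obtain ⟨S, hS1, hS2⟩ := exists_layers G k hk hG (2 * m)
  set d := 2 * m * (k - 1) with hd
  have hdpos : 0 < d := by
    have : 0 < k - 1 := by omega
    positivity
  have hd0 : (0 : ℝ) < d := by exact_mod_cast hdpos
  have hΔ0 : (0 : ℝ) < G.maxDegree := by exact_mod_cast hΔ
  let N : V → Finset V := fun v => S.filter (fun u => G.Adj v u)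
  replace hS1 : ∀ v, (N v).card ≤ d := by
    intro v
    convert hS1 v
  replace hS2 : ∀ v, v ∉ S → 2 * m ≤ (N v).card := by
    intro v hv
    convert hS2 v hv
  -- coloring of `S`
  let ι := {v : V // (N v).Nonempty}
  have : Nonempty (Fin (18 * d)) := ⟨⟨0, by omega⟩⟩
  obtain ⟨f, hf⟩ := local_cf (V := V) (ι := ι) (α := Fin (18 * d)) (fun i => N i.1)
    (fun i => i.2) (fun i => if i.1 ∈ S then 2 / (3 * (d : ℝ)) else 1 / (3 * (G.maxDegree : ℝ)))
    (by
      rintro ⟨v, hv⟩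
      dsimp only
      have hs1 : 1 ≤ (N v).card := Finset.card_pos.2 hv
      have hsd : (N v).card ≤ d := hS1 v
      by_cases hs : 2 ≤ (N v).card
      · have h1 := card_bad (18 * d) (N v) (by omega)
        have h1' := (Nat.cast_le (α := ℝ)).2 h1
        push_cast at h1'
        have h2 := weight_bound d (N v).card hs hsd
        have h3 : (2 * ((N v).card / 2 : ℕ) / (3 * d) : ℝ) ^ ((N v).card / 2) ≤
            if v ∈ S then 2 / (3 * (d : ℝ)) else 1 / (3 * (G.maxDegree : ℝ)) := by
          split_ifs with hvS
          · exact weight_small d _ hs hsd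
          · exact weight_large d _ m _ hm (hS2 v hvS) hsd hΔ hm3
        set W : ℝ := if v ∈ S then 2 / (3 * (d : ℝ)) else 1 / (3 * (G.maxDegree : ℝ))
        set b := ((univ.filter (fun f : V → Fin (18 * d) => ¬ HasUniq f (N v))).card : ℝ)
        have hpos : (0 : ℝ) < (9 * d) ^ (N v).card := by positivity
        refine le_of_mul_le_mul_right ?_ hpos
        have h4 : ((18 : ℝ) * d) ^ (N v).card = 2 ^ (N v).card * (9 * d) ^ (N v).card := by
          rw [← mul_pow]; congr 1; ring
        rw [h4] at h1'
        have h5 : (Fintype.card (V → Fin (18 * d)) : ℝ) = (18 * d) ^ Fintype.card V := by simp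
        calc b * 2 ^ (N v).card * (9 * d) ^ (N v).card
            = b * (2 ^ (N v).card * (9 * d) ^ (N v).card) := by ring
          _ ≤ _ := h1'
          _ ≤ (W * (9 * d) ^ (N v).card) * Fintype.card (V → Fin (18 * d)) := by
              rw [h5]
              refine mul_le_mul_of_nonneg_right (h2.trans ?_) (by positivity)
              gcongr
          _ = _ := by ring
      · have hs' : (N v).card = 1 := by omega
        obtain ⟨p, hp⟩ := Finset.card_eq_one.1 hs'
        have : univ.filter (fun f : V → Fin (18 * d) => ¬ HasUniq f (N v)) = ∅ := by
          apply Finset.filter_eq_empty_iff.2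
          intro f _ h
          apply h
          rw [hp]
          exact ⟨p, by simp, fun y hy hyp => absurd (by simpa using hy) hyp⟩
        rw [this]
        simp only [card_empty, Nat.cast_zero, zero_mul]
        split_ifs <;> positivity)
    (by
      intro x
      rw [Finset.sum_ite, Finset.sum_const, Finset.sum_const, nsmul_eq_mul, nsmul_eq_mul]
      have h1 : ((univ.filter (fun i : ι => x ∈ N i.1)).filter (fun i => i.1 ∈ S)).card ≤ d := by
        refine le_trans ?_ (hS1 x)
        apply Finset.card_le_card_of_injOn (fun i => i.1)
        · intro i hi
          simp only [N, coe_filter, mem_filter, mem_univ, true_and, Set.mem_ofPred_eq] at hi ⊢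
          exact ⟨hi.2, hi.1.2.symm⟩
        · intro i _ j _ h
          exact Subtype.ext h
      have h2 : ((univ.filter (fun i : ι => x ∈ N i.1)).filter (fun i => i.1 ∉ S)).card ≤
          G.maxDegree := by
        refine le_trans ?_ (G.degree_le_maxDegree x)
        rw [← G.card_neighborFinset_eq_degree]
        apply Finset.card_le_card_of_injOn (fun i => i.1)
        · intro i hi
          simp only [N, coe_filter, mem_filter, mem_univ, true_and, Set.mem_ofPred_eq] at hi
          simpa using hi.1.2.symm
        · intro i _ j _ h
          exact Subtype.ext h
      have h1' := (Nat.cast_le (α := ℝ)).2 h1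
      have h2' := (Nat.cast_le (α := ℝ)).2 h2
      calc _ ≤ (d : ℝ) * (2 / (3 * (d : ℝ))) + G.maxDegree * (1 / (3 * (G.maxDegree : ℝ))) := by
            gcongr
        _ = 1 := by field_simp; norm_num)
  -- coloring outside `S`
  let U : Finset V := S.filter (fun v => ¬ (N v).Nonempty)
  have hU : ∀ u ∈ U, ∀ w ∈ U, ¬ G.Adj u w := by
    intro u hu w hw h
    simp only [U, mem_filter] at hu hw
    exact hu.2 ⟨w, by simp [N, hw.1, h]⟩
  obtain ⟨g, hg⟩ := greedy_cf (ι := {v // v ∈ U}) (fun v => G.neighborFinset v.1) (k - 1) (by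
    intro x
    refine le_trans ?_ (indep_nbr G k hk hG U hU x)
    apply Finset.card_le_card_of_injOn (fun i => i.1)
    · intro i hi
      simp only [coe_filter, mem_univ, true_and, Set.mem_ofPred_eq,
        SimpleGraph.mem_neighborFinset] at hi ⊢
      exact ⟨i.2, hi.symm⟩
    · intro i _ j _ h
      exact Subtype.ext h)
  let F : V → Fin (18 * d) ⊕ Fin (k - 1 + 1) := fun v => if v ∈ S then Sum.inl (f v) else
    Sum.inr (g v)
  have := chiON_le_of G F (by
    intro v
    by_cases hv : (N v).Nonempty
    · obtain ⟨p, hp, h2⟩ := hf ⟨v, hv⟩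
      simp only [N, mem_filter] at hp h2
      refine ⟨p, hp.2, fun y hy hyp => ?_⟩
      by_cases hyS : y ∈ S
      · simpa [F, hyS, hp.1] using h2 y ⟨hyS, hy⟩ hyp
      · simp [F, hyS, hp.1]
    · have hvS : v ∈ S := by
        by_contra h
        have h1 := hS2 v h
        exact hv (Finset.card_pos.1 (by omega))
      have hout : ∀ y, G.Adj v y → y ∉ S := fun y hy hyS => hv ⟨y, by simp [N, hyS, hy]⟩
      obtain ⟨u, hu⟩ := hiso v
      obtain ⟨p, hp, h2⟩ := hg ⟨v, by simp only [U, mem_filter]; exact ⟨hvS, hv⟩⟩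
        ⟨u, by simpa using hu⟩
      simp only [SimpleGraph.mem_neighborFinset] at hp h2
      refine ⟨p, hp, fun y hy hyp => ?_⟩
      simpa [F, hout y hy, hout p hp] using h2 y hy hyp)
  rw [Fintype.card_sum, Fintype.card_fin, Fintype.card_fin] at this
  have h36 : 18 * d = 36 * m * (k - 1) := by rw [hd]; ring
  omega

lemma chiON_explicit {V : Type} [Fintype V] (G : SimpleGraph V) [DecidableRel G.Adj] (k : ℕ)
    (hk : 2 ≤ k) (hG : K1kFree G k) (hΔ : 2 ≤ G.maxDegree) (hiso : ∀ v : V, ∃ u : V, G.Adj v u) :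
    (chiON G : ℝ) ≤ 46 * k * Real.log G.maxDegree + 2 * k + 3 := by
  set D := G.maxDegree with hD
  have hk' : (2 : ℝ) ≤ k := by exact_mod_cast hk
  have hl2 := Real.log_two_gt_d9
  have hD0 : (0 : ℝ) < D := by exact_mod_cast (by omega : 0 < D)
  by_cases hbig : 256 ≤ D
  · have hL : 8 * Real.log 2 ≤ Real.log D := by
      have : Real.log ((2 : ℝ) ^ 8) ≤ Real.log D := by
        apply Real.log_le_log (by norm_num)
        norm_num
        exact_mod_cast hbig
      rw [Real.log_pow] at this
      exact_mod_cast this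
    have hl3 := Real.log_three_gt_d9
    set c := Nat.clog 3 D with hc
    have hc1 : 1 ≤ c := Nat.clog_pos (by norm_num) hΔ
    have h1 : 3 ^ (c - 1) < D := Nat.pow_pred_clog_lt_self (by norm_num) (by omega)
    have h2 : D ≤ 3 ^ c := Nat.le_pow_clog (by norm_num) D
    have h3 : ((c : ℝ) - 1) * Real.log 3 ≤ Real.log D := by
      have : Real.log ((3 : ℝ) ^ (c - 1)) ≤ Real.log D := by
        apply Real.log_le_log (by positivity)
        exact_mod_cast h1.le
      rw [Real.log_pow, Nat.cast_sub hc1] at this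
      simpa using this
    have h4 := chiON_le_layers G k hk hG hiso (by omega) (c + 1) (by omega)
      (by rw [pow_succ, ← hD]; omega)
    have h5 : (chiON G : ℝ) ≤ 36 * (c + 1) * k + k := by
      have h6 : chiON G ≤ 36 * (c + 1) * k + k :=
        h4.trans (by gcongr; omega)
      exact_mod_cast h6
    have hcc : (1 : ℝ) ≤ c := by exact_mod_cast hc1
    have h7 : 36 * ((c : ℝ) + 1) ≤ 46 * Real.log D := by nlinarith
    nlinarith
  · have h0 := chiON_le_maxDegree G hiso
    have h0' : (chiON G : ℝ) ≤ D + 1 := by exact_mod_cast h0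
    by_cases h64 : 64 ≤ D
    · have hL : 6 * Real.log 2 ≤ Real.log D := by
        have : Real.log ((2 : ℝ) ^ 6) ≤ Real.log D := by
          apply Real.log_le_log (by norm_num)
          norm_num
          exact_mod_cast h64
        rw [Real.log_pow] at this
        exact_mod_cast this
      have : (D : ℝ) ≤ 256 := by exact_mod_cast (by omega : D ≤ 256)
      nlinarith
    · have hL : Real.log 2 ≤ Real.log D := by
        apply Real.log_le_log (by norm_num)
        exact_mod_cast hΔ
      have : (D : ℝ) ≤ 63 := by exact_mod_cast (by omega : D ≤ 63)
      nlinarith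

theorem chiON_K1kFree_le :
    ∃ C : ℝ, 0 < C ∧
      ∀ (V : Type) [Fintype V] (G : SimpleGraph V) [DecidableRel G.Adj] (k : ℕ),
        2 ≤ k → K1kFree G k → 2 ≤ G.maxDegree → (∀ v : V, ∃ u : V, G.Adj v u) →
        (chiON G : ℝ) ≤ C * k * Real.log G.maxDegree ∧
        (chiON G : ℝ) ≤ 46 * k * Real.log G.maxDegree + 2 * k + 3 := by
  refine ⟨100, by norm_num, ?_⟩
  intro V _ G _ k hk hG hΔ hiso
  have h := chiON_explicit G k hk hG hΔ hiso
  refine ⟨?_, h⟩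
  have hk' : (2 : ℝ) ≤ k := by exact_mod_cast hk
  have hl2 := Real.log_two_gt_d9
  have hL : Real.log 2 ≤ Real.log G.maxDegree := by
    apply Real.log_le_log (by norm_num)
    exact_mod_cast hΔ
  nlinarith
end

section
/- Let G be a graph with maximum degree Δ in which every vertex has degree at least cΔ/ln^ε Δ for some constants c > 0 and ε ≥ 0 (with Δ sufficiently large). Then there exists a subset A ⊆ V(G) such that for every vertex v ∈ V(G), 108·ln(2Δ) < |N(v) ∩ A| < (180/c)·ln^{1+ε}(2Δ). -/
/-- Weight of the random subset `A` of `S`. -/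
noncomputable def wt {V : Type} [DecidableEq V] (p : ℝ) (S A : Finset V) : ℝ :=
  (∏ _u ∈ A, p) * ∏ _u ∈ S \ A, (1 - p)

/-- Expectation over random subsets of `S`. -/
noncomputable def ex {V : Type} [DecidableEq V] (p : ℝ) (S : Finset V) (f : Finset V → ℝ) : ℝ :=
  ∑ A ∈ S.powerset, wt p S A * f A

lemma wt_nonneg {V : Type} [DecidableEq V] {p : ℝ} (h0 : 0 ≤ p) (h1 : p ≤ 1) (S A : Finset V) :
    0 ≤ wt p S A := by
  unfold wt
  exact mul_nonneg (Finset.prod_nonneg fun _ _ => h0)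
    (Finset.prod_nonneg fun _ _ => sub_nonneg.2 h1)

lemma ex_one {V : Type} [DecidableEq V] (p : ℝ) (S : Finset V) : ex p S (fun _ => 1) = 1 := by
  have h := Finset.prod_add (fun _ : V => p) (fun _ => 1 - p) S
  simp only [add_sub_cancel, Finset.prod_const_one] at h
  simp only [ex, wt, mul_one]
  exact h.symm

lemma ex_mono {V : Type} [DecidableEq V] {p : ℝ} (h0 : 0 ≤ p) (h1 : p ≤ 1) (S : Finset V)
    {f g : Finset V → ℝ} (h : ∀ A, f A ≤ g A) : ex p S f ≤ ex p S g :=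
  Finset.sum_le_sum fun A _ => mul_le_mul_of_nonneg_left (h A) (wt_nonneg h0 h1 S A)

lemma ex_add {V : Type} [DecidableEq V] (p : ℝ) (S : Finset V) (f g : Finset V → ℝ) :
    ex p S (fun A => f A + g A) = ex p S f + ex p S g := by
  simp [ex, mul_add, Finset.sum_add_distrib]

lemma ex_sum {V ι : Type} [DecidableEq V] (p : ℝ) (S : Finset V) (T : Finset ι)
    (f : ι → Finset V → ℝ) :
    ex p S (fun A => ∑ i ∈ T, f i A) = ∑ i ∈ T, ex p S (f i) := by
  simp only [ex, Finset.mul_sum]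
  rw [Finset.sum_comm]

lemma ex_mul_const {V : Type} [DecidableEq V] (p : ℝ) (S : Finset V) (f : Finset V → ℝ) (a : ℝ) :
    ex p S (fun A => f A * a) = ex p S f * a := by
  simp only [ex, Finset.sum_mul, mul_assoc]

lemma ex_split {V : Type} [Fintype V] [DecidableEq V] (p : ℝ) (S : Finset V)
    (f g : Finset V → ℝ) (hf : ∀ A, f A = f (A ∩ S)) (hg : ∀ A, g A = g (A \ S)) :
    ex p Finset.univ (fun A => f A * g A) = ex p S f * ex p Sᶜ g := by
  unfold ex
  rw [Finset.sum_mul_sum, ← Finset.sum_product']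
  refine Finset.sum_bij' (fun A _ => (A ∩ S, A \ S)) (fun B _ => B.1 ∪ B.2) ?_ ?_ ?_ ?_ ?_
  · intro A _
    simp only [Finset.mem_product, Finset.mem_powerset]
    exact ⟨Finset.inter_subset_right, fun x hx => by simp at hx ⊢; exact hx.2⟩
  · intro B _; simp
  · intro A _
    ext x; simp; tauto
  · rintro ⟨B, C⟩ h
    simp only [Finset.mem_product, Finset.mem_powerset] at h
    have h1 : ∀ x, x ∈ B → x ∈ S := fun x hx => h.1 hx
    have h2 : ∀ x, x ∈ C → x ∉ S := fun x hx => by simpa using h.2 hx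
    simp only [Prod.mk.injEq]
    constructor <;> ext x <;> simp <;> have := h1 x <;> have := h2 x <;> tauto
  · intro A _
    have hw : wt p Finset.univ A = wt p S (A ∩ S) * wt p Sᶜ (A \ S) := by
      unfold wt
      have e1 : (∏ _u ∈ A, p) = (∏ _u ∈ A ∩ S, p) * ∏ _u ∈ A \ S, p :=
        (Finset.prod_inter_mul_prod_diff A S _).symm
      have e2 : (∏ _u ∈ Finset.univ \ A, (1 - p)) =
          (∏ _u ∈ S \ (A ∩ S), (1 - p)) * ∏ _u ∈ Sᶜ \ (A \ S), (1 - p) := by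
        rw [← Finset.prod_inter_mul_prod_diff (Finset.univ \ A) S]
        congr 1
        · congr 1; ext x; simp; tauto
        · congr 1; ext x; simp; tauto
      rw [e1, e2]; ring
    simp only
    rw [hw, hf A, hg A]; ring

lemma ex_indep {V : Type} [Fintype V] [DecidableEq V] (p : ℝ) (S : Finset V)
    (f g : Finset V → ℝ) (hf : ∀ A, f A = f (A ∩ S)) (hg : ∀ A, g A = g (A \ S)) :
    ex p Finset.univ (fun A => f A * g A) = ex p Finset.univ f * ex p Finset.univ g := by
  have h1 := ex_split p S f (fun _ => 1) hf (fun _ => rfl)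
  have h2 := ex_split p S (fun _ => 1) g (fun _ => rfl) hg
  rw [ex_one] at h1 h2
  simp only [mul_one, one_mul] at h1 h2
  rw [ex_split p S f g hf hg, h1, h2]

lemma ex_mgf {V : Type} [Fintype V] [DecidableEq V] (p r : ℝ) (S : Finset V) :
    ex p Finset.univ (fun A => r ^ (S ∩ A).card) = (1 - p + p * r) ^ S.card := by
  have h := Finset.prod_add (fun u : V => p * (if u ∈ S then r else 1)) (fun _ => 1 - p) Finset.univ
  have h2 : ∏ u : V, (p * (if u ∈ S then r else 1) + (1 - p)) = (1 - p + p * r) ^ S.card := by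
    have : ∀ u : V, (p * (if u ∈ S then r else 1) + (1 - p)) =
      if u ∈ S then (1 - p + p * r) else 1 := by
      intro u; split_ifs <;> ring
    simp only [this]
    rw [Finset.prod_ite_mem, Finset.univ_inter, Finset.prod_const]
  rw [← h2, h]
  unfold ex wt
  refine Finset.sum_congr rfl fun A _ => ?_
  rw [Finset.prod_mul_distrib, Finset.prod_ite_mem, Finset.prod_const r, Finset.inter_comm A S]
  ring

/-- Symmetric local lemma. `b i` is the indicator of the bad event. -/
lemma lll {V : Type} [Fintype V] [DecidableEq V] {p : ℝ} (h0 : 0 ≤ p) (h1 : p ≤ 1)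
    (N : V → Finset V) (Γ : V → Finset V) (hΓ : ∀ i j, j ∉ Γ i → Disjoint (N i) (N j))
    (B : V → Finset V → Prop) [∀ i A, Decidable (B i A)]
    (hB : ∀ i A A', N i ∩ A = N i ∩ A' → (B i A ↔ B i A'))
    (q D : ℝ) (hD : ∀ i, ((Γ i).card : ℝ) ≤ D) (hq0 : 0 ≤ q) (hq : 4 * D * q ≤ 1) (hq2 : 2 * q < 1)
    (hP : ∀ i, ex p Finset.univ (fun A => if B i A then 1 else 0) ≤ q) :
    ∃ A, ∀ i, ¬ B i A := by
  classical
  set b : V → Finset V → ℝ := fun i A => if B i A then 1 else 0 with hb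
  set n : Finset V → Finset V → ℝ := fun S A => if ∀ i ∈ S, ¬ B i A then 1 else 0 with hn
  have hn0 : ∀ S, 0 ≤ ex p Finset.univ (n S) := fun S =>
    Finset.sum_nonneg fun A _ => mul_nonneg (wt_nonneg h0 h1 _ _) (by simp only [hn]; split_ifs <;> norm_num)
  have key : ∀ k : ℕ, ∀ S : Finset V, S.card = k → ∀ i,
      ex p Finset.univ (fun A => b i A * n S A) ≤ 2 * q * ex p Finset.univ (n S) := by
    intro k
    induction k using Nat.strong_induction_on with
    | _ k ih =>
      intro S hS i
      set S2 := S \ Γ i with hS2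
      set S1 := S ∩ Γ i with hS1
      have a1 : ex p Finset.univ (fun A => b i A * n S A) ≤
          ex p Finset.univ (fun A => b i A * n S2 A) := by
        apply ex_mono h0 h1
        intro A
        have hb0 : 0 ≤ b i A := by simp only [hb]; split_ifs <;> norm_num
        apply mul_le_mul_of_nonneg_left _ hb0
        simp only [hn]
        split_ifs with h h'
        · norm_num
        · exact absurd (fun j hj => h j (Finset.sdiff_subset hj)) h'
        · norm_num
        · norm_num
      have a2 : ex p Finset.univ (fun A => b i A * n S2 A) =
          ex p Finset.univ (b i) * ex p Finset.univ (n S2) := by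
        apply ex_indep p (N i)
        · intro A
          simp only [hb]
          have := hB i A (A ∩ N i) (by ext x; simp; tauto)
          simp only [this]
        · intro A
          simp only [hn]
          have : ∀ j ∈ S2, (B j A ↔ B j (A \ N i)) := by
            intro j hj
            apply hB j
            have hd := hΓ i j (by simp [hS2] at hj; exact hj.2)
            ext x
            have : x ∈ N j → x ∉ N i := fun h h' => (Finset.disjoint_left.1 hd) h' h
            simp; tauto
          have h' : (∀ j ∈ S2, ¬ B j A) ↔ (∀ j ∈ S2, ¬ B j (A \ N i)) :=
            forall₂_congr fun j hj => not_congr (this j hj)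
          simp only [h']
      have a3 : ex p Finset.univ (n S2) ≤ ex p Finset.univ (n S) +
          ∑ j ∈ S1, ex p Finset.univ (fun A => b j A * n S2 A) := by
        rw [← ex_sum, ← ex_add]
        apply ex_mono h0 h1
        intro A
        have hnn : ∀ j ∈ S1, 0 ≤ b j A * n S2 A := by
          intro j _
          simp only [hn, hb]
          split_ifs <;> norm_num
        by_cases h2 : ∀ j ∈ S2, ¬ B j A
        · by_cases h : ∀ j ∈ S, ¬ B j A
          · have e : n S A = 1 := if_pos h
            have e2 : n S2 A = 1 := if_pos h2
            rw [e, e2]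
            have := Finset.sum_nonneg hnn
            rw [e2] at this
            linarith
          · push Not at h
            obtain ⟨j, hj, hBj⟩ := h
            have hj1 : j ∈ S1 := by
              by_contra hc
              exact h2 j (by simp [hS1, hS2] at hc ⊢; tauto) hBj
            have := Finset.single_le_sum hnn hj1
            have e : b j A = 1 := if_pos hBj
            rw [e, one_mul] at this
            have : 0 ≤ n S A := by simp only [hn]; split_ifs <;> norm_num
            linarith
        · have e2 : n S2 A = 0 := if_neg h2
          rw [e2]
          have := Finset.sum_nonneg hnn
          rw [e2] at this
          have : 0 ≤ n S A := by simp only [hn]; split_ifs <;> norm_num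
          linarith
      have a4 : ∑ j ∈ S1, ex p Finset.univ (fun A => b j A * n S2 A) ≤
          ∑ j ∈ S1, 2 * q * ex p Finset.univ (n S2) := by
        apply Finset.sum_le_sum
        intro j hj
        apply ih S2.card _ S2 rfl
        rw [← hS]
        apply Finset.card_lt_card
        rw [Finset.ssubset_iff_of_subset Finset.sdiff_subset]
        simp only [hS1, Finset.mem_inter] at hj
        exact ⟨j, hj.1, by simp [hS2, hj.2]⟩
      rw [Finset.sum_const, nsmul_eq_mul] at a4
      have hc : (S1.card : ℝ) ≤ D :=
        le_trans (by exact_mod_cast Finset.card_le_card Finset.inter_subset_right) (hD i)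
      have a5 := mul_le_mul_of_nonneg_right hc (mul_nonneg (mul_nonneg zero_le_two hq0) (hn0 S2))
      have a6 := mul_le_mul_of_nonneg_right hq (hn0 S2)
      have a7 : ex p Finset.univ (n S2) ≤ 2 * ex p Finset.univ (n S) := by linarith
      have a8 := mul_le_mul_of_nonneg_right (hP i) (hn0 S2)
      have a9 := mul_le_mul_of_nonneg_left a7 hq0
      rw [a2] at a1
      linarith
  have pos : ∀ S : Finset V, 0 < ex p Finset.univ (n S) := by
    intro S
    induction S using Finset.induction_on with
    | empty =>
      have : n ∅ = fun _ => 1 := by funext A; simp [hn]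
      rw [this, ex_one]; norm_num
    | insert i S hi ih =>
      have h := key _ S rfl i
      have e : ex p Finset.univ (n S) = ex p Finset.univ (n (insert i S)) +
          ex p Finset.univ (fun A => b i A * n S A) := by
        rw [← ex_add]
        congr 1
        funext A
        simp only [hn, hb, Finset.forall_mem_insert]
        by_cases hh : B i A <;> by_cases h2 : ∀ j ∈ S, ¬ B j A <;> simp [hh, h2]
      nlinarith
  by_contra hcon
  push Not at hcon
  have : n Finset.univ = fun _ => 0 := by
    funext A
    obtain ⟨i, hi⟩ := hcon A
    exact if_neg fun h => h i (Finset.mem_univ i) hi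
  have h := pos Finset.univ
  rw [this] at h
  simp [ex] at h

lemma log_four_thirds : Real.log (4 / 3) ≤ 33 / 108 := by
  rw [Real.log_le_iff_le_exp (by norm_num)]
  have := Real.quadratic_le_exp_of_nonneg (x := 33 / 108) (by norm_num)
  refine le_trans ?_ this
  norm_num

lemma log_five_fourths : 13 / 60 ≤ Real.log (5 / 4) := by
  rw [Real.le_log_iff_exp_le (by norm_num)]
  have h := Real.one_sub_le_exp_neg (13 / 240)
  have h2 := pow_le_pow_left₀ (by norm_num) h 4
  rw [← Real.exp_nat_mul] at h2
  have h3 : ((4 : ℕ) : ℝ) * -(13 / 240) = -(13 / 60) := by norm_num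
  rw [h3, Real.exp_neg] at h2
  have h4 : (4 / 5 : ℝ) ≤ (Real.exp (13 / 60))⁻¹ := le_trans (by norm_num) h2
  have := inv_anti₀ (by norm_num) h4
  rw [inv_inv] at this
  norm_num at this ⊢
  exact this

lemma tail_low {V : Type} [Fintype V] [DecidableEq V] {p : ℝ} (h0 : 0 ≤ p) (h1 : p ≤ 1)
    (S : Finset V) (L : ℝ) (hL : 0 ≤ L) (hm : 144 * L ≤ p * S.card) :
    ex p Finset.univ (fun A => if ((S ∩ A).card : ℝ) ≤ 108 * L then 1 else 0)
      ≤ Real.exp (-(3 * L)) := by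
  have a1 : ex p Finset.univ (fun A => if ((S ∩ A).card : ℝ) ≤ 108 * L then 1 else 0) ≤
      ex p Finset.univ (fun A => (3 / 4 : ℝ) ^ (S ∩ A).card * Real.exp (108 * L * Real.log (4 / 3))) := by
    apply ex_mono h0 h1
    intro A
    split_ifs with h
    · have : (3 / 4 : ℝ) ^ (S ∩ A).card = Real.exp (-((S ∩ A).card * Real.log (4 / 3))) := by
        rw [← mul_neg, ← Real.log_inv, Real.exp_nat_mul, Real.exp_log (by norm_num)]
        norm_num
      rw [this, ← Real.exp_add]
      apply Real.one_le_exp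
      have : 0 ≤ Real.log (4 / 3) := Real.log_nonneg (by norm_num)
      nlinarith
    · positivity
  rw [ex_mul_const, ex_mgf] at a1
  refine a1.trans ?_
  have a2 : (1 - p + p * (3 / 4)) ^ S.card ≤ Real.exp (-(p * S.card / 4)) := by
    have : 1 - p + p * (3 / 4) ≤ Real.exp (-(p / 4)) := by
      have := Real.one_sub_le_exp_neg (p / 4); linarith
    refine (pow_le_pow_left₀ (by linarith) this _).trans ?_
    rw [← Real.exp_nat_mul]
    apply le_of_eq; congr 1; ring
  refine (mul_le_mul_of_nonneg_right a2 (Real.exp_pos _).le).trans ?_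
  rw [← Real.exp_add, Real.exp_le_exp]
  have := mul_le_mul_of_nonneg_left log_four_thirds hL
  linarith

lemma tail_high {V : Type} [Fintype V] [DecidableEq V] {p : ℝ} (h0 : 0 ≤ p) (h1 : p ≤ 1)
    (S : Finset V) (L M : ℝ) (hM0 : 0 ≤ M) (hM : 144 * L ≤ M) (hm : p * S.card ≤ M) :
    ex p Finset.univ (fun A => if 5 / 4 * M ≤ ((S ∩ A).card : ℝ) then 1 else 0)
      ≤ Real.exp (-(3 * L)) := by
  have a1 : ex p Finset.univ (fun A => if 5 / 4 * M ≤ ((S ∩ A).card : ℝ) then 1 else 0) ≤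
      ex p Finset.univ (fun A => (5 / 4 : ℝ) ^ (S ∩ A).card * Real.exp (-(5 / 4 * M * Real.log (5 / 4)))) := by
    apply ex_mono h0 h1
    intro A
    split_ifs with h
    · have : (5 / 4 : ℝ) ^ (S ∩ A).card = Real.exp (((S ∩ A).card * Real.log (5 / 4))) := by
        rw [Real.exp_nat_mul, Real.exp_log (by norm_num)]
      rw [this, ← Real.exp_add]
      apply Real.one_le_exp
      have : 0 ≤ Real.log (5 / 4) := Real.log_nonneg (by norm_num)
      nlinarith
    · positivity
  rw [ex_mul_const, ex_mgf] at a1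
  refine a1.trans ?_
  have a2 : (1 - p + p * (5 / 4)) ^ S.card ≤ Real.exp (p * S.card / 4) := by
    have : 1 - p + p * (5 / 4) ≤ Real.exp (p / 4) := by
      have := Real.add_one_le_exp (p / 4); linarith
    refine (pow_le_pow_left₀ (by linarith) this _).trans ?_
    rw [← Real.exp_nat_mul]
    apply le_of_eq; congr 1; ring
  refine (mul_le_mul_of_nonneg_right a2 (Real.exp_pos _).le).trans ?_
  rw [← Real.exp_add, Real.exp_le_exp]
  have := mul_le_mul_of_nonneg_left log_five_fourths hM0
  linarith

lemma threshold (c ε : ℝ) (hc : 0 < c) :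
    ∃ Δ₀ : ℕ, ∀ n : ℕ, Δ₀ ≤ n → 144 * Real.log (2 * n) ^ (1 + ε) ≤ c * n := by
  have h := (isLittleO_log_rpow_rpow_atTop (1 + ε) (zero_lt_one' ℝ)).def
    (show (0 : ℝ) < c / 288 by positivity)
  have ht : Filter.Tendsto (fun n : ℕ => 2 * (n : ℝ)) Filter.atTop Filter.atTop :=
    Filter.Tendsto.const_mul_atTop (by norm_num) tendsto_natCast_atTop_atTop
  obtain ⟨N, hN⟩ := Filter.eventually_atTop.1 (ht.eventually h)
  refine ⟨N, fun n hn => ?_⟩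
  have := hN n hn
  rw [Real.rpow_one, Real.norm_of_nonneg (by positivity : (0 : ℝ) ≤ 2 * n)] at this
  have := (le_abs_self _).trans this
  linarith

theorem exists_subset_balanced_neighborhoods (c ε : ℝ) (hc : 0 < c) (hε : 0 ≤ ε) :
    ∃ Δ₀ : ℕ, ∀ (V : Type) [Fintype V] [DecidableEq V] (G : SimpleGraph V) [DecidableRel G.Adj],
      Δ₀ ≤ G.maxDegree →
      (∀ v : V, c * G.maxDegree / (Real.log G.maxDegree) ^ ε ≤ (G.degree v : ℝ)) →
      ∃ A : Finset V, ∀ v : V,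
        108 * Real.log (2 * G.maxDegree) < ((G.neighborFinset v ∩ A).card : ℝ) ∧
        ((G.neighborFinset v ∩ A).card : ℝ) < (180 / c) * Real.log (2 * G.maxDegree) ^ (1 + ε) := by
  obtain ⟨N, hN⟩ := threshold c ε hc
  refine ⟨max N 2, ?_⟩
  intro V _ _ G _ hΔ hdeg
  classical
  have hthr := hN _ (le_trans (le_max_left _ _) hΔ)
  have h2 : 2 ≤ G.maxDegree := le_trans (le_max_right _ _) hΔ
  have hle : ∀ v, G.degree v ≤ G.maxDegree := G.degree_le_maxDegree
  have hcard : ∀ v, (G.neighborFinset v).card = G.degree v := fun v => rfl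
  set n : ℕ := G.maxDegree with hn
  clear_value n
  have hn2 : (2 : ℝ) ≤ n := by exact_mod_cast h2
  have hn0 : (0 : ℝ) < n := by linarith
  have hl : 0 < Real.log n := Real.log_pos (by linarith)
  set L := Real.log (2 * n) with hLdef
  have hlL : Real.log n ≤ L := Real.log_le_log hn0 (by linarith)
  have hL : 0 < L := by linarith
  set M := 144 / c * L ^ (1 + ε) with hMdef
  have hM0 : 0 < M := by positivity
  set p := M / n with hp
  have hp0 : 0 ≤ p := by positivity
  have hp1 : p ≤ 1 := by
    rw [hp, div_le_one hn0, hMdef, div_mul_eq_mul_div, div_le_iff₀ hc]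
    linarith
  have hlow : ∀ v, 144 * L ≤ p * (G.neighborFinset v).card := by
    intro v
    rw [hcard]
    refine le_trans ?_ (mul_le_mul_of_nonneg_left (hdeg v) hp0)
    have hpw : Real.log n ^ ε ≤ L ^ ε := Real.rpow_le_rpow hl.le hlL hε
    have hlp : 0 < Real.log n ^ ε := Real.rpow_pos_of_pos hl ε
    have e : p * (c * n / Real.log n ^ ε) = 144 * (L * L ^ ε) / Real.log n ^ ε := by
      rw [hp, hMdef, Real.rpow_add hL, Real.rpow_one]
      field_simp
    rw [e, le_div_iff₀ hlp]
    have := mul_le_mul_of_nonneg_left hpw hL.le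
    linarith
  have hhigh : ∀ v, p * (G.neighborFinset v).card ≤ M := by
    intro v
    rw [hcard]
    have : (G.degree v : ℝ) ≤ n := by exact_mod_cast hle v
    refine (mul_le_mul_of_nonneg_left this hp0).trans (le_of_eq ?_)
    rw [hp]; field_simp
  have hexp : Real.exp (-(3 * L)) = 1 / (8 * (n : ℝ) ^ 3) := by
    rw [Real.exp_neg, show 3 * L = ((3 : ℕ) : ℝ) * L by norm_num, Real.exp_nat_mul, hLdef,
      Real.exp_log (by linarith)]
    rw [mul_pow]; norm_num
  have := lll hp0 hp1 (fun v => G.neighborFinset v)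
    (fun v => (G.neighborFinset v).biUnion fun u => G.neighborFinset u) ?_
    (fun v A => ((G.neighborFinset v ∩ A).card : ℝ) ≤ 108 * L ∨
      5 / 4 * M ≤ ((G.neighborFinset v ∩ A).card : ℝ)) ?_
    (2 * Real.exp (-(3 * L))) ((n : ℝ) ^ 2) ?_ (by positivity) ?_ ?_ ?_
  · obtain ⟨A, hA⟩ := this
    refine ⟨A, fun v => ?_⟩
    have h := hA v
    push Not at h
    refine ⟨h.1, h.2.trans_eq ?_⟩
    rw [hMdef]; ring
  · intro i j hj
    rw [Finset.disjoint_left]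
    intro x hx hx'
    apply hj
    simp only [Finset.mem_biUnion, SimpleGraph.mem_neighborFinset] at hx hx' ⊢
    exact ⟨x, hx, hx'.symm⟩
  · intro i A A' h
    simp only [h]
  · intro i
    have h := Finset.card_biUnion_le_card_mul (G.neighborFinset i) (fun u => G.neighborFinset u) n
      (fun u _ => hle u)
    have h' : ((G.neighborFinset i).biUnion fun u => G.neighborFinset u).card ≤ n ^ 2 := by
      refine h.trans ?_
      rw [sq]
      exact Nat.mul_le_mul_right _ (hle i)
    exact_mod_cast h'
  · rw [hexp]
    have : 4 * (n : ℝ) ^ 2 * (2 * (1 / (8 * (n : ℝ) ^ 3))) = 1 / n := by field_simp; norm_num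
    rw [this, div_le_one hn0]; linarith
  · rw [hexp]
    have : (8 : ℝ) ≤ n ^ 3 := by
      have := pow_le_pow_left₀ (by norm_num) hn2 3
      linarith
    have h : 1 / (8 * (n : ℝ) ^ 3) ≤ 1 / 64 := one_div_le_one_div_of_le (by norm_num) (by linarith)
    linarith
  · intro i
    have t1 := tail_low hp0 hp1 (G.neighborFinset i) L hL.le (hlow i)
    have t2 := tail_high hp0 hp1 (G.neighborFinset i) L M hM0.le ((hlow i).trans (hhigh i)) (hhigh i)
    have t3 := add_le_add t1 t2
    rw [← ex_add] at t3
    rw [two_mul]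
    refine le_trans (ex_mono hp0 hp1 _ ?_) t3
    intro A
    by_cases g1 : ((G.neighborFinset i ∩ A).card : ℝ) ≤ 108 * L <;>
      by_cases g2 : 5 / 4 * M ≤ ((G.neighborFinset i ∩ A).card : ℝ) <;> simp [g1, g2]
end
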